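/- Let G = (N, E) be an unweighted graph with |N| = n and let i ≥ 0. Then the raw Shapley value of the vertex y_i in the matching game MG(G_i) satisfies: κ_{y_i}(MG(G_i)) = C(i) + Σ_{k=0}^{n} (k+i)! · (n−k)! · ᾱ_k(G) if i is even, and κ_{y_i}(MG(G_i)) = C(i) + Σ_{k=0}^{n} (k+i)! · (n−k)! · α_k(G) if i is odd, where C(i) = Σ_{k=1}^{⌊i/2⌋} Σ_{j=0}^{n+i−2k} (j+2k−1)! · (n+i−j−2k+1)! · binom(n+i−2k, j). -/

import Mathlib

attribute [local instance] Classical.propDecidable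

/-- `M` is a matching of the subgraph of the graph with edge set `E` induced by
the vertex set `S`. -/
def IsMatchingOn {V : Type*} (E : Finset (Sym2 V)) (S : Finset V) (M : Finset (Sym2 V)) : Prop :=
  M ⊆ E ∧ (∀ e ∈ M, ¬ e.IsDiag) ∧ (∀ e ∈ M, ∀ x ∈ e, x ∈ S) ∧
    (∀ e ∈ M, ∀ f ∈ M, e ≠ f → ∀ x ∈ e, x ∉ f)

/-- Value of a coalition `S` in the weighted matching game on the graph with edge set `E` and
weights `w`: the maximum total weight of a matching in the induced subgraph on `S`. -/
noncomputable def matchVal {V : Type*} (E : Finset (Sym2 V)) (w : Sym2 V → ℝ)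
    (S : Finset V) : ℝ :=
  sSup {x : ℝ | ∃ M : Finset (Sym2 V), IsMatchingOn E S M ∧ x = ∑ e ∈ M, w e}

/-- Value of a coalition `S` in the unweighted matching game: the maximum cardinality of a
matching in the induced subgraph on `S`. -/
noncomputable def umatchVal {V : Type*} (E : Finset (Sym2 V)) (S : Finset V) : ℕ :=
  sSup {k : ℕ | ∃ M : Finset (Sym2 V), IsMatchingOn E S M ∧ k = M.card}

/-- The Shapley value of player `i` in the cooperative game with (finite) player set `N` and
characteristic function `v`. -/
noncomputable def shapley {V : Type*} [DecidableEq V] (N : Finset V) (v : Finset V → ℝ)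
    (i : V) : ℝ :=
  (1 / (Nat.factorial N.card) : ℝ) *
    ∑ S ∈ (N.erase i).powerset,
      (Nat.factorial S.card : ℝ) * (Nat.factorial (N.card - S.card - 1) : ℝ) *
        (v (insert i S) - v S)

/-- The raw Shapley value of player `i` in the cooperative game with player set `N` and
characteristic function `v`. -/
noncomputable def rawShapley {V : Type*} [DecidableEq V] (N : Finset V) (v : Finset V → ℝ)
    (i : V) : ℝ :=
  ∑ S ∈ (N.erase i).powerset,
    (Nat.factorial S.card : ℝ) * (Nat.factorial (N.card - S.card - 1) : ℝ) *
      (v (insert i S) - v S)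

/-- The subgraph induced by `S` of the graph with edge set `E` admits a perfect matching. -/
def PerfMatchable {V : Type*} (E : Finset (Sym2 V)) (S : Finset V) : Prop :=
  ∃ M : Finset (Sym2 V), IsMatchingOn E S M ∧ ∀ x ∈ S, ∃ e ∈ M, x ∈ e

/-- Edge set of `G` viewed inside the vertex type `V ⊕ ℕ`, where `Sum.inr j` is the added
vertex `y_j`. -/
noncomputable def leftEdges {V : Type*} (E : Finset (Sym2 V)) : Finset (Sym2 (V ⊕ ℕ)) :=
  E.image (Sym2.map Sum.inl)

/-- Edge set of the graph `G_i`: the edges of `G`, edges from `y_0` to every vertex of `G`, and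
the path edges `{y_{j-1}, y_j}` for `j = 1, …, i`. -/
noncomputable def GiEdges {V : Type*} [Fintype V] (E : Finset (Sym2 V)) (i : ℕ) : Finset (Sym2 (V ⊕ ℕ)) :=
  leftEdges E ∪ Finset.univ.image (fun x : V => s(Sum.inr 0, Sum.inl x)) ∪
    (Finset.Icc 1 i).image (fun j : ℕ => s(Sum.inr (j - 1), Sum.inr j))

/-- Vertex (player) set of the graph `G_i`: the vertices of `G` together with `y_0, …, y_i`. -/
noncomputable def GiPlayers (V : Type*) [Fintype V] (i : ℕ) : Finset (V ⊕ ℕ) :=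
  Finset.univ.image Sum.inl ∪ (Finset.range (i + 1)).image Sum.inr

/-- Number of `k`-element vertex subsets of `G` whose induced subgraph is perfectly
matchable. -/
noncomputable def alphaK {V : Type*} [Fintype V] (E : Finset (Sym2 V)) (k : ℕ) : ℕ :=
  ((Finset.univ : Finset V).powerset.filter
    (fun S => S.card = k ∧ PerfMatchable E S)).card

section Matching

open Finset

variable {V : Type*} {E E' M : Finset (Sym2 V)} {S : Finset V} {x y : V}

lemma IsMatchingOn.card_le_umatchVal (h : IsMatchingOn E S M) : M.card ≤ umatchVal E S :=
  le_csSup ⟨E.card, by rintro _ ⟨M, hM, rfl⟩; exact card_le_card hM.1⟩ ⟨M, h, rfl⟩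

lemma exists_isMatchingOn_card_eq_umatchVal (E : Finset (Sym2 V)) (S : Finset V) :
    ∃ M, IsMatchingOn E S M ∧ M.card = umatchVal E S := by
  have h := Nat.sSup_mem (s := {k : ℕ | ∃ M, IsMatchingOn E S M ∧ k = M.card})
    ⟨0, ∅, by simp [IsMatchingOn], by simp⟩
    ⟨E.card, by rintro _ ⟨M, hM, rfl⟩; exact card_le_card hM.1⟩
  obtain ⟨M, hM, hc⟩ := h
  exact ⟨M, hM, hc.symm⟩

lemma umatchVal_le {k : ℕ} (h : ∀ M, IsMatchingOn E S M → M.card ≤ k) : umatchVal E S ≤ k := by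
  obtain ⟨M, hM, hc⟩ := exists_isMatchingOn_card_eq_umatchVal E S
  exact hc ▸ h M hM

lemma umatchVal_congr (h : ∀ e : Sym2 V, (∀ x ∈ e, x ∈ S) → (e ∈ E ↔ e ∈ E')) :
    umatchVal E S = umatchVal E' S := by
  have key : ∀ M, IsMatchingOn E S M ↔ IsMatchingOn E' S M := fun M =>
    ⟨fun ⟨h1, h2, h3, h4⟩ => ⟨fun e he => (h e (h3 e he)).1 (h1 he), h2, h3, h4⟩,
      fun ⟨h1, h2, h3, h4⟩ => ⟨fun e he => (h e (h3 e he)).2 (h1 he), h2, h3, h4⟩⟩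
  simp only [umatchVal, key]

lemma umatchVal_mono {T : Finset V} (h : S ⊆ T) : umatchVal E S ≤ umatchVal E T :=
  umatchVal_le fun _ hM => IsMatchingOn.card_le_umatchVal
    ⟨hM.1, hM.2.1, fun e he x hx => h (hM.2.2.1 e he x hx), hM.2.2.2⟩

/-- Adding an edge between two uncovered vertices extends a matching. -/
lemma IsMatchingOn.insert_edge {T : Finset V} (hM : IsMatchingOn E S M) (hST : S ⊆ T)
    (hxy : s(x, y) ∈ E) (hne : x ≠ y) (hxT : x ∈ T) (hyT : y ∈ T)
    (hx : ∀ e ∈ M, x ∉ e) (hy : ∀ e ∈ M, y ∉ e) :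
    IsMatchingOn E T (insert s(x, y) M) ∧ (insert s(x, y) M).card = M.card + 1 := by
  obtain ⟨h1, h2, h3, h4⟩ := hM
  refine ⟨⟨insert_subset hxy h1, ?_, ?_, ?_⟩, card_insert_of_notMem fun h => hx _ h (by simp)⟩
  · intro e he
    rcases mem_insert.1 he with rfl | he
    · simpa using hne
    · exact h2 e he
  · intro e he z hz
    rcases mem_insert.1 he with rfl | he
    · rcases Sym2.mem_iff.1 hz with rfl | rfl <;> assumption
    · exact hST (h3 e he z hz)
  · intro e he f hf hef z hz hz'
    obtain he' | he' := mem_insert.1 he <;> obtain hf' | hf' := mem_insert.1 hf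
    · exact hef (he'.trans hf'.symm)
    · rcases Sym2.mem_iff.1 (he' ▸ hz) with rfl | rfl
      exacts [hx f hf' hz', hy f hf' hz']
    · rcases Sym2.mem_iff.1 (hf' ▸ hz') with rfl | rfl
      exacts [hx e he' hz, hy e he' hz]
    · exact h4 e he' f hf' hef z hz hz'

/-- A matching loses at most one edge when the edges at a given vertex are removed. -/
lemma IsMatchingOn.card_le_card_filter_add_one [DecidableEq V] (hM : IsMatchingOn E S M) (x : V) :
    M.card ≤ (M.filter fun e => x ∉ e).card + 1 := by
  rw [← card_filter_add_card_filter_not (s := M) (fun e => x ∉ e)]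
  gcongr
  refine card_le_one.2 fun e he f hf => ?_
  simp only [mem_filter, not_not] at he hf
  by_contra hne
  exact hM.2.2.2 e he.1 f hf.1 hne x he.2 hf.2

lemma IsMatchingOn.filter {T : Finset V} (hM : IsMatchingOn E S M) (p : Sym2 V → Prop) [DecidablePred p]
    (h : ∀ e ∈ M, p e → ∀ x ∈ e, x ∈ T) : IsMatchingOn E T (M.filter p) := by
  obtain ⟨h1, h2, h3, h4⟩ := hM
  refine ⟨(filter_subset _ _).trans h1, fun e he => h2 e (mem_filter.1 he).1,
    fun e he => h e (mem_filter.1 he).1 (mem_filter.1 he).2, fun e he f hf =>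
      h4 e (mem_filter.1 he).1 f (mem_filter.1 hf).1⟩

lemma umatchVal_insert_le [DecidableEq V] : umatchVal E (insert y S) ≤ umatchVal E S + 1 := by
  refine umatchVal_le fun M hM => (hM.card_le_card_filter_add_one y).trans ?_
  gcongr
  refine (hM.filter (_ ∉ ·) fun e he hy z hz => ?_).card_le_umatchVal
  exact mem_of_mem_insert_of_ne (hM.2.2.1 e he z hz) fun h => hy (h ▸ hz)

/-- If the only neighbour `x` of `y` is absent, then `y` contributes nothing. -/
lemma umatchVal_insert_of_notMem [DecidableEq V] (hy : ∀ e ∈ E, y ∈ e → e = s(x, y)) (hne : x ≠ y) (hx : x ∉ S) :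
    umatchVal E (insert y S) = umatchVal E S := by
  refine le_antisymm (umatchVal_le fun M hM => ?_) (umatchVal_mono (subset_insert _ _))
  refine IsMatchingOn.card_le_umatchVal ⟨hM.1, hM.2.1, fun e he z hz => ?_, hM.2.2.2⟩
  refine mem_of_mem_insert_of_ne (hM.2.2.1 e he z hz) fun h => hx ?_
  have hxe : x ∈ e := by rw [hy e (hM.1 he) (h ▸ hz)]; simp
  exact mem_of_mem_insert_of_ne (hM.2.2.1 e he x hxe) hne

/-- If `x` is the only neighbour of `y`, some maximum matching uses the edge `{x, y}`. -/
lemma umatchVal_insert_insert [DecidableEq V] (hy : ∀ e ∈ E, y ∈ e → e = s(x, y)) (hE : s(x, y) ∈ E)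
    (hne : x ≠ y) (hxS : x ∉ S) (hyS : y ∉ S) :
    umatchVal E (insert y (insert x S)) = umatchVal E S + 1 := by
  apply le_antisymm
  · refine umatchVal_le fun M hM => (hM.card_le_card_filter_add_one x).trans ?_
    gcongr
    refine (hM.filter (_ ∉ ·) fun e he hx z hz => ?_).card_le_umatchVal
    have hzx : z ≠ x := fun h => hx (h ▸ hz)
    have hzy : z ≠ y := fun h => hx (by rw [hy e (hM.1 he) (h ▸ hz)]; simp)
    have := hM.2.2.1 e he z hz
    simpa [hzx, hzy] using this
  · obtain ⟨M, hM, hc⟩ := exists_isMatchingOn_card_eq_umatchVal E S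
    obtain ⟨h, hc'⟩ := hM.insert_edge (T := insert y (insert x S))
      ((subset_insert _ _).trans (subset_insert _ _)) hE hne (by simp) (by simp)
      (fun e he h => hxS (hM.2.2.1 e he x h)) (fun e he h => hyS (hM.2.2.1 e he y h))
    rw [← hc, ← hc']
    exact h.card_le_umatchVal

lemma IsMatchingOn.card_biUnion_toFinset [DecidableEq V] (hM : IsMatchingOn E S M) :
    (M.biUnion Sym2.toFinset).card = 2 * M.card := by
  rw [card_biUnion, sum_congr rfl fun e he => Sym2.card_toFinset_of_not_isDiag e (hM.2.1 e he),
    sum_const, smul_eq_mul, mul_comm]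
  intro e he f hf hef
  rw [Function.onFun, disjoint_left]
  simpa using hM.2.2.2 e he f hf hef

lemma IsMatchingOn.two_mul_card_le (hM : IsMatchingOn E S M) : 2 * M.card ≤ S.card := by
  rw [← hM.card_biUnion_toFinset]
  refine card_le_card fun x hx => ?_
  obtain ⟨e, he, hx⟩ := mem_biUnion.1 hx
  exact hM.2.2.1 e he x (by simpa using hx)

/-- A vertex adjacent to all of `S` contributes one edge unless `S` is perfectly matchable. -/
lemma umatchVal_insert_of_adj_all [DecidableEq V] (hy : y ∉ S) (hadj : ∀ x ∈ S, s(x, y) ∈ E) :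
    umatchVal E (insert y S) = umatchVal E S + if PerfMatchable E S then 0 else 1 := by
  split_ifs with hS
  · refine le_antisymm (umatchVal_le fun M hM => ?_) (umatchVal_mono (subset_insert _ _))
    obtain ⟨P, hP, hcov⟩ := hS
    have h1 := hM.two_mul_card_le
    have h2 := hP.card_biUnion_toFinset
    have h3 : S.card ≤ (P.biUnion Sym2.toFinset).card := card_le_card fun x hx => by
      simpa using hcov x hx
    have h4 := hP.card_le_umatchVal
    rw [card_insert_of_notMem hy] at h1
    omega
  · refine le_antisymm umatchVal_insert_le ?_
    obtain ⟨M, hM, hc⟩ := exists_isMatchingOn_card_eq_umatchVal E S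
    have : ∃ x ∈ S, ∀ e ∈ M, x ∉ e := by
      by_contra! h
      exact hS ⟨M, hM, h⟩
    obtain ⟨x, hxS, hx⟩ := this
    obtain ⟨h, hc'⟩ := hM.insert_edge (T := insert y S) (subset_insert _ _) (hadj x hxS)
      (fun h => hy (h ▸ hxS)) (by simp [hxS]) (by simp) hx
      (fun e he h => hy (hM.2.2.1 e he y h))
    rw [← hc, ← hc']
    exact h.card_le_umatchVal

lemma PerfMatchable.congr (h : ∀ e : Sym2 V, (∀ x ∈ e, x ∈ S) → (e ∈ E → e ∈ E'))
    (hS : PerfMatchable E S) : PerfMatchable E' S := by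
  obtain ⟨M, hM, hcov⟩ := hS
  exact ⟨M, ⟨fun e he => h e (hM.2.2.1 e he) (hM.1 he), hM.2⟩, hcov⟩

lemma perfMatchable_image {W : Type*} [DecidableEq W] {f : V → W} (hf : Function.Injective f) :
    PerfMatchable (E.image (Sym2.map f)) (S.image f) ↔ PerfMatchable E S := by
  constructor
  · rintro ⟨M, ⟨h1, h2, h3, h4⟩, hcov⟩
    refine ⟨E.filter fun e => Sym2.map f e ∈ M, ⟨filter_subset _ _, ?_, ?_, ?_⟩, ?_⟩
    · intro e he hd
      refine h2 _ (mem_filter.1 he).2 ?_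
      induction e with | _ a b => simpa using congrArg f (by simpa using hd)
    · intro e he x hx
      have := h3 _ (mem_filter.1 he).2 (f x) (Sym2.mem_map.2 ⟨x, hx, rfl⟩)
      simpa [hf.eq_iff] using this
    · intro e he g hg hne x hx hx'
      exact h4 _ (mem_filter.1 he).2 _ (mem_filter.1 hg).2
        (fun h => hne (Sym2.map.injective hf h)) (f x) (Sym2.mem_map.2 ⟨x, hx, rfl⟩)
        (Sym2.mem_map.2 ⟨x, hx', rfl⟩)
    · intro x hx
      obtain ⟨e, he, hxe⟩ := hcov (f x) (mem_image_of_mem f hx)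
      obtain ⟨g, hg, rfl⟩ := mem_image.1 (h1 he)
      refine ⟨g, mem_filter.2 ⟨hg, he⟩, ?_⟩
      obtain ⟨z, hz, hzx⟩ := Sym2.mem_map.1 hxe
      exact hf hzx ▸ hz
  · rintro ⟨M, ⟨h1, h2, h3, h4⟩, hcov⟩
    refine ⟨M.image (Sym2.map f), ⟨image_subset_image h1, ?_, ?_, ?_⟩, ?_⟩
    · simp only [forall_mem_image]
      intro e he hd
      refine h2 e he ?_
      induction e with | _ a b => simpa [hf.eq_iff] using hd
    · simp only [forall_mem_image]
      intro e he x hx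
      obtain ⟨z, hz, rfl⟩ := Sym2.mem_map.1 hx
      exact mem_image_of_mem f (h3 e he z hz)
    · simp only [forall_mem_image]
      intro e he g hg hne x hx hx'
      obtain ⟨z, hz, rfl⟩ := Sym2.mem_map.1 hx
      obtain ⟨z', hz', h⟩ := Sym2.mem_map.1 hx'
      exact h4 e he g hg (fun h => hne (h ▸ rfl)) z hz (hf h ▸ hz')
    · simp only [forall_mem_image]
      intro x hx
      obtain ⟨e, he, hxe⟩ := hcov x hx
      exact ⟨_, mem_image_of_mem _ he, Sym2.mem_map.2 ⟨x, hxe, rfl⟩⟩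

end Matching

section Gi

open Finset

variable {V : Type*} [Fintype V] {E : Finset (Sym2 V)}

lemma mem_GiEdges {i : ℕ} {e : Sym2 (V ⊕ ℕ)} : e ∈ GiEdges E i ↔
    (∃ f ∈ E, Sym2.map Sum.inl f = e) ∨ (∃ x : V, s(Sum.inr 0, Sum.inl x) = e) ∨
      ∃ j < i, s(Sum.inr j, Sum.inr (j + 1)) = e := by
  simp only [GiEdges, leftEdges, mem_union, mem_image, mem_univ, true_and, mem_Icc, or_assoc]
  refine or_congr_right (or_congr_right ⟨?_, ?_⟩)
  · rintro ⟨j, ⟨h1, h2⟩, rfl⟩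
    exact ⟨j - 1, by omega, by rw [Nat.sub_add_cancel h1]⟩
  · rintro ⟨j, h, rfl⟩
    exact ⟨j + 1, ⟨by omega, by omega⟩, rfl⟩

lemma eq_of_inr_mem_GiEdges {i : ℕ} {e : Sym2 (V ⊕ ℕ)} (he : e ∈ GiEdges E (i + 1))
    (h : Sum.inr (i + 1) ∈ e) : e = s(Sum.inr i, Sum.inr (i + 1)) := by
  rcases mem_GiEdges.1 he with ⟨f, -, rfl⟩ | ⟨x, rfl⟩ | ⟨j, hj, rfl⟩
  · simp at h
  · simp at h
  · have : j = i := by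
      simp at h
      omega
    rw [this]

/-- The vertices of `G` together with `y_0, …, y_{i-1}`. -/
noncomputable def playersBefore (V : Type*) [Fintype V] (i : ℕ) : Finset (V ⊕ ℕ) :=
  univ.image Sum.inl ∪ (range i).image Sum.inr

lemma inr_mem_playersBefore {i j : ℕ} : Sum.inr j ∈ playersBefore V i ↔ j < i := by
  simp [playersBefore]

lemma playersBefore_succ (i : ℕ) :
    playersBefore V (i + 1) = insert (Sum.inr i) (playersBefore V i) := by
  simp [playersBefore, range_add_one, image_insert]

lemma card_playersBefore (i : ℕ) : (playersBefore V i).card = Fintype.card V + i := by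
  rw [playersBefore, card_union_of_disjoint, card_image_of_injective _ Sum.inl_injective,
    card_image_of_injective _ Sum.inr_injective, card_range, card_univ]
  simp [disjoint_left]

/-- The marginal contribution of `y_i` to the coalition `S`. -/
noncomputable def marginal (E : Finset (Sym2 V)) (i : ℕ) (S : Finset (V ⊕ ℕ)) : ℝ :=
  (umatchVal (GiEdges E i) (insert (Sum.inr i) S) : ℝ) - umatchVal (GiEdges E i) S

lemma marginal_zero (A : Finset V) :
    marginal E 0 (A.image Sum.inl) = if PerfMatchable E A then 0 else 1 := by
  have hadj : ∀ x ∈ A.image Sum.inl, s(x, Sum.inr 0) ∈ GiEdges E 0 := by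
    simp only [forall_mem_image]
    exact fun x _ => mem_GiEdges.2 (Or.inr (Or.inl ⟨x, Sym2.eq_swap⟩))
  have hPM : PerfMatchable (GiEdges E 0) (A.image Sum.inl) ↔ PerfMatchable E A := by
    rw [← perfMatchable_image (f := (Sum.inl : V → V ⊕ ℕ)) Sum.inl_injective]
    refine ⟨PerfMatchable.congr fun e h he => ?_, PerfMatchable.congr fun e _ he => ?_⟩
    swap
    · exact mem_GiEdges.2 (Or.inl (mem_image.1 he))
    rcases mem_GiEdges.1 he with hf | ⟨x, rfl⟩ | ⟨j, hj, -⟩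
    · simpa using hf
    · simpa using h (Sum.inr 0) (by simp)
    · omega
  rw [marginal, umatchVal_insert_of_adj_all (by simp) hadj]
  simp [hPM]

lemma marginal_succ_of_notMem {i : ℕ} {S : Finset (V ⊕ ℕ)} (h : Sum.inr i ∉ S) :
    marginal E (i + 1) S = 0 := by
  rw [marginal, umatchVal_insert_of_notMem (fun e => eq_of_inr_mem_GiEdges) (by simp) h, sub_self]

lemma umatchVal_GiEdges_succ {i : ℕ} {S : Finset (V ⊕ ℕ)} (h : Sum.inr (i + 1) ∉ S) :
    umatchVal (GiEdges E (i + 1)) S = umatchVal (GiEdges E i) S := by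
  refine umatchVal_congr fun e he => ?_
  simp only [mem_GiEdges]
  refine or_congr_right (or_congr_right ⟨?_, ?_⟩)
  · rintro ⟨j, hj, rfl⟩
    refine ⟨j, lt_of_le_of_ne (by omega) ?_, rfl⟩
    rintro rfl
    exact h (he _ (by simp))
  · rintro ⟨j, hj, rfl⟩
    exact ⟨j, by omega, rfl⟩

lemma marginal_succ_insert {i : ℕ} {S : Finset (V ⊕ ℕ)} (hS : S ⊆ playersBefore V i) :
    marginal E (i + 1) (insert (Sum.inr i) S) = 1 - marginal E i S := by
  have hi : Sum.inr i ∉ S := fun h => absurd (inr_mem_playersBefore.1 (hS h)) (by omega)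
  have hi' : Sum.inr (i + 1) ∉ S := fun h => absurd (inr_mem_playersBefore.1 (hS h)) (by omega)
  rw [marginal, marginal, umatchVal_insert_insert (fun e => eq_of_inr_mem_GiEdges)
    (mem_GiEdges.2 (Or.inr (Or.inr ⟨i, by omega, rfl⟩))) (by simp) hi hi',
    umatchVal_GiEdges_succ hi', umatchVal_GiEdges_succ (by simp [hi'])]
  push_cast
  ring

/-- The total marginal contribution of `y_i`, where coalitions of size `s` have weight `w s`. -/
noncomputable def weightedMarginal (E : Finset (Sym2 V)) (i : ℕ) (w : ℕ → ℝ) : ℝ :=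
  ∑ S ∈ (playersBefore V i).powerset, w S.card * marginal E i S

lemma powerset_playersBefore_zero :
    (playersBefore V 0).powerset = univ.image fun A : Finset V => A.image Sum.inl := by
  rw [playersBefore, range_zero, image_empty, union_empty, powerset_image, powerset_univ]

lemma weightedMarginal_zero (w : ℕ → ℝ) : weightedMarginal E 0 w =
    ∑ A : Finset V, w A.card * if PerfMatchable E A then 0 else 1 := by
  rw [weightedMarginal, powerset_playersBefore_zero, sum_image (image_injective Sum.inl_injective).injOn]
  simp only [marginal_zero, card_image_of_injective _ Sum.inl_injective]

lemma weightedMarginal_succ (i : ℕ) (w : ℕ → ℝ) : weightedMarginal E (i + 1) w =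
    ∑ S ∈ (playersBefore V i).powerset, w (S.card + 1) * (1 - marginal E i S) := by
  have hi : Sum.inr i ∉ playersBefore V i := by simp [inr_mem_playersBefore]
  rw [weightedMarginal, playersBefore_succ, sum_powerset_insert hi, sum_eq_zero, zero_add]
  · refine sum_congr rfl fun S hS => ?_
    rw [marginal_succ_insert (mem_powerset.1 hS),
      card_insert_of_notMem fun h => hi (mem_powerset.1 hS h)]
  · intro S hS
    rw [marginal_succ_of_notMem fun h => hi (mem_powerset.1 hS h), mul_zero]

lemma weightedMarginal_one (w : ℕ → ℝ) : weightedMarginal E 1 w =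
    ∑ A : Finset V, w (A.card + 1) * if PerfMatchable E A then 1 else 0 := by
  rw [weightedMarginal_succ, powerset_playersBefore_zero, sum_image (image_injective Sum.inl_injective).injOn]
  refine sum_congr rfl fun A _ => ?_
  rw [marginal_zero, card_image_of_injective _ Sum.inl_injective]
  split_ifs <;> simp

lemma weightedMarginal_add_two (i : ℕ) (w : ℕ → ℝ) : weightedMarginal E (i + 2) w =
    ∑ j ∈ range (Fintype.card V + i + 1), w (j + 1) * (Fintype.card V + i).choose j +
      weightedMarginal E i fun s => w (s + 2) := by
  have hi : Sum.inr i ∉ playersBefore V i := by simp [inr_mem_playersBefore]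
  rw [weightedMarginal_succ, playersBefore_succ, sum_powerset_insert hi]
  congr 1
  · rw [← card_playersBefore (V := V) i]
    have := sum_powerset_apply_card (fun s => w (s + 1)) (x := playersBefore V i)
    simp only [nsmul_eq_mul] at this
    simp only [mul_comm (w _) (Nat.cast _)]
    rw [← this]
    refine sum_congr rfl fun S hS => ?_
    rw [marginal_succ_of_notMem fun h => hi (mem_powerset.1 hS h), sub_zero, mul_one]
  · refine sum_congr rfl fun S hS => ?_
    rw [marginal_succ_insert (mem_powerset.1 hS),
      card_insert_of_notMem fun h => hi (mem_powerset.1 hS h), sub_sub_cancel]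

lemma weightedMarginal_add_two_mul (i m : ℕ) (w : ℕ → ℝ) : weightedMarginal E (i + 2 * m) w =
    ∑ k ∈ Icc 1 m, ∑ j ∈ range (Fintype.card V + (i + 2 * m) - 2 * k + 1),
        w (j + 2 * k - 1) * (Fintype.card V + (i + 2 * m) - 2 * k).choose j +
      weightedMarginal E i fun s => w (s + 2 * m) := by
  induction m generalizing w with
  | zero => simp
  | succ m ih =>
    rw [show i + 2 * (m + 1) = i + 2 * m + 2 by ring, weightedMarginal_add_two, ih, ← add_assoc]
    congr 1
    simp only [← Ico_add_one_right_eq_Icc]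
    rw [sum_eq_sum_Ico_succ_bot (by omega : 1 < m + 1 + 1)]
    congr 1
    rw [← sum_Ico_add' _ 1 (m + 1) 1]
    refine sum_congr rfl fun k hk => ?_
    have := mem_Ico.1 hk
    rw [show Fintype.card V + (i + 2 * m + 2) - 2 * (k + 1)
      = Fintype.card V + (i + 2 * m) - 2 * k by omega]
    refine sum_congr rfl fun j _ => ?_
    rw [show j + 2 * (k + 1) - 1 = j + 2 * k - 1 + 2 by omega]

lemma sum_perfMatchable (w : ℕ → ℝ) :
    (∑ A : Finset V, w A.card * if PerfMatchable E A then 1 else 0) =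
      ∑ k ∈ range (Fintype.card V + 1), w k * alphaK E k := by
  rw [← sum_fiberwise_of_maps_to (t := range (Fintype.card V + 1)) (g := card)
    fun A _ => mem_range.2 (Nat.lt_succ_of_le (card_le_univ A))]
  refine sum_congr rfl fun k _ => ?_
  rw [alphaK, powerset_univ, ← filter_filter, card_filter, Nat.cast_sum, mul_sum]
  refine sum_congr rfl fun A hA => ?_
  rw [(mem_filter.1 hA).2]
  simp

lemma sum_not_perfMatchable (w : ℕ → ℝ) :
    (∑ A : Finset V, w A.card * if PerfMatchable E A then 0 else 1) =
      ∑ k ∈ range (Fintype.card V + 1), w k * ((Fintype.card V).choose k - alphaK E k) := by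
  have hall : ∑ A : Finset V, w A.card =
      ∑ k ∈ range (Fintype.card V + 1), w k * (Fintype.card V).choose k := by
    simpa [mul_comm] using sum_powerset_apply_card w (x := (univ : Finset V))
  simp only [mul_sub, sum_sub_distrib]
  rw [← hall, ← sum_perfMatchable, ← sum_sub_distrib]
  refine sum_congr rfl fun A _ => ?_
  split_ifs <;> simp

lemma rawShapley_GiPlayers (i : ℕ) :
    rawShapley (GiPlayers V i) (fun S => (umatchVal (GiEdges E i) S : ℝ)) (Sum.inr i) =
      weightedMarginal E i fun s =>
        (Nat.factorial s : ℝ) * Nat.factorial (Fintype.card V + i - s) := by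
  have hP : GiPlayers V i = playersBefore V (i + 1) := rfl
  rw [rawShapley, weightedMarginal, hP, card_playersBefore, playersBefore_succ,
    erase_insert (by simp [inr_mem_playersBefore])]
  refine sum_congr rfl fun S _ => ?_
  rw [show Fintype.card V + (i + 1) - S.card - 1 = Fintype.card V + i - S.card by omega]
  rfl

end Gi

/-- The raw Shapley value of `y_i` in the matching game on `G_i` equals
`C(i) + Σ_{k=0}^{n} (k+i)! (n-k)! ᾱ_k(G)` for even `i`, and
`C(i) + Σ_{k=0}^{n} (k+i)! (n-k)! α_k(G)` for odd `i`. -/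
theorem rawShapley_Gi {V : Type*} [Fintype V] [DecidableEq V]
    (E : Finset (Sym2 V)) (hloop : ∀ e ∈ E, ¬ e.IsDiag)
    (i : ℕ) (n : ℕ) (hn : n = Fintype.card V)
    (C : ℝ)
    (hC : C = ∑ k ∈ Finset.Icc 1 (i / 2), ∑ j ∈ Finset.range (n + i - 2 * k + 1),
      (Nat.factorial (j + 2 * k - 1) : ℝ) * (Nat.factorial (n + i - j - 2 * k + 1) : ℝ) *
        ((n + i - 2 * k).choose j : ℝ)) :
    (Even i →
      rawShapley (GiPlayers V i) (fun S => (umatchVal (GiEdges E i) S : ℝ)) (Sum.inr i)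
        = C + ∑ k ∈ Finset.range (n + 1),
            (Nat.factorial (k + i) : ℝ) * (Nat.factorial (n - k) : ℝ) *
              ((n.choose k : ℝ) - (alphaK E k : ℝ))) ∧
    (Odd i →
      rawShapley (GiPlayers V i) (fun S => (umatchVal (GiEdges E i) S : ℝ)) (Sum.inr i)
        = C + ∑ k ∈ Finset.range (n + 1),
            (Nat.factorial (k + i) : ℝ) * (Nat.factorial (n - k) : ℝ) * (alphaK E k : ℝ)) := by
  subst hn hC
  have hκ : rawShapley (GiPlayers V i) (fun S => (umatchVal (GiEdges E i) S : ℝ)) (Sum.inr i) =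
      weightedMarginal E i fun s =>
        (Nat.factorial s : ℝ) * Nat.factorial (Fintype.card V + i - s) := by
    convert rawShapley_GiPlayers i
  rw [hκ]
  clear hκ
  constructor
  · rintro ⟨m, rfl⟩
    rw [← two_mul]
    have h := weightedMarginal_add_two_mul (E := E) 0 m fun s =>
      (Nat.factorial s : ℝ) * Nat.factorial (Fintype.card V + 2 * m - s)
    rw [zero_add] at h
    rw [h, weightedMarginal_zero, sum_not_perfMatchable fun s => (Nat.factorial (s + 2 * m) : ℝ) *
      Nat.factorial (Fintype.card V + 2 * m - (s + 2 * m)), Nat.mul_div_cancel_left m two_pos]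
    congr 1
    · refine Finset.sum_congr rfl fun k hk => Finset.sum_congr rfl fun j hj => ?_
      have := Finset.mem_Icc.1 hk
      have := Finset.mem_range.1 hj
      congr 4
      omega
    · simp only [Nat.add_sub_add_right]
  · rintro ⟨m, rfl⟩
    have h := weightedMarginal_add_two_mul (E := E) 1 m fun s =>
      (Nat.factorial s : ℝ) * Nat.factorial (Fintype.card V + (2 * m + 1) - s)
    rw [add_comm 1] at h
    rw [h, weightedMarginal_one, sum_perfMatchable fun s =>
      (Nat.factorial (s + 1 + 2 * m) : ℝ) *
        Nat.factorial (Fintype.card V + (2 * m + 1) - (s + 1 + 2 * m)),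
      show (2 * m + 1) / 2 = m by omega]
    congr 1
    · refine Finset.sum_congr rfl fun k hk => Finset.sum_congr rfl fun j hj => ?_
      have := Finset.mem_Icc.1 hk
      have := Finset.mem_range.1 hj
      congr 4
      omega
    · refine Finset.sum_congr rfl fun k _ => ?_
      rw [show k + 1 + 2 * m = k + (2 * m + 1) by ring, Nat.add_sub_add_right]
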